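/- For any two non-isomorphic finite trees S₁ and S₂ each having at least 3 vertices, the total variation distance between the laws of T_n^{(S₁)} and T_n^{(S₂)} stays bounded away from 0: liminf_{n→∞} d_TV(T_n^{(S₁)}, T_n^{(S₂)}) > 0. Consequently, d(S₁,S₂) := lim_{n→∞} d_TV(T_n^{(S₁)}, T_n^{(S₂)}) defines a metric on the set of isomorphism classes of trees with at least 3 vertices. -/

import Mathlib

open Finset

noncomputable section

namespace LPAM

attribute [local instance] Classical.propDecidable

/-- The tree obtained from `G` by attaching a new vertex (the last element of `Fin (n+1)`)
to the vertex `v` of `G`. -/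
def attach {n : ℕ} (G : SimpleGraph (Fin n)) (v : Fin n) : SimpleGraph (Fin (n + 1)) :=
  SimpleGraph.fromRel fun a b =>
    (∃ a' b' : Fin n, a = a'.castSucc ∧ b = b'.castSucc ∧ G.Adj a' b') ∨
    (a = Fin.last n ∧ b = v.castSucc)

/-- The degree of a vertex. -/
def deg {n : ℕ} (G : SimpleGraph (Fin n)) (v : Fin n) : ℕ := (G.neighborSet v).ncard

/-- The law of the linear preferential attachment tree after `k` steps started from the
seed `S`: at each step, a new vertex is joined by an edge to a random vertex of the current
tree chosen with probability proportional to its degree. -/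
def law {n₀ : ℕ} (S : SimpleGraph (Fin n₀)) : (k : ℕ) → SimpleGraph (Fin (n₀ + k)) → ℝ
  | 0, G => if G = S then 1 else 0
  | (k + 1), G =>
      ∑ H : SimpleGraph (Fin (n₀ + k)), ∑ v : Fin (n₀ + k),
        law S k H * ((deg H v : ℝ) / (2 * (n₀ + k : ℕ) - 2)) *
          (if attach H v = G then 1 else 0)

/-- The law of the preferential attachment tree `T_n^{(S)}` with seed `S`, as a function on
graphs on `Fin n` (zero if `n < |S|`). -/
def lawAt {n₀ : ℕ} (S : SimpleGraph (Fin n₀)) (n : ℕ) (G : SimpleGraph (Fin n)) : ℝ :=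
  if h : n₀ ≤ n then
    law S (n - n₀) (cast (congrArg (fun m => SimpleGraph (Fin m)) (Nat.add_sub_cancel' h).symm) G)
  else 0

/-- A decorated tree: a finite tree together with a positive integer label on each vertex. -/
structure DecTree where
  n : ℕ
  graph : SimpleGraph (Fin n)
  isTree : graph.IsTree
  label : Fin n → ℕ
  label_pos : ∀ u, 0 < label u

/-- The weight of a decorated tree: the sum of its labels. -/
def DecTree.weight (τ : DecTree) : ℕ := ∑ u, τ.label u

/-- The strict partial order `≺` on decorated trees. -/
def DecTree.lt (τ' τ : DecTree) : Prop :=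
  (τ'.weight < τ.weight ∧ τ'.n ≤ τ.n) ∨ (τ'.weight = τ.weight ∧ τ'.n < τ.n)

/-- The partial order `⪯` associated with `≺`. -/
def DecTree.le (τ' τ : DecTree) : Prop := DecTree.lt τ' τ ∨ τ' = τ

/-- The observable `D_τ(T) = ∑_φ ∏_{u ∈ τ} [deg_T φ(u)]_{ℓ(u)}`, the sum running over all
embeddings (injective graph homomorphisms) `φ : τ → T`. -/
def Dval (τ : DecTree) {m : ℕ} (T : SimpleGraph (Fin m)) : ℝ :=
  ∑ φ : Fin τ.n → Fin m,
    if Function.Injective φ ∧ ∀ a b, τ.graph.Adj a b → T.Adj (φ a) (φ b) then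
      ∏ u, ((deg T (φ u)).descFactorial (τ.label u) : ℝ)
    else 0

/-- The expectation `E[D_τ(T_n^{(S)})]`. -/
def expD {n₀ : ℕ} (S : SimpleGraph (Fin n₀)) (τ : DecTree) (n : ℕ) : ℝ :=
  ∑ G : SimpleGraph (Fin n), lawAt S n G * Dval τ G

/-- `a ≪ b` : there are `c > 0` and `γ ∈ ℝ` with `|a_n| ≤ c (log n)^γ |b_n|` for `n` large. -/
def Lsim (a b : ℕ → ℝ) : Prop :=
  ∃ c γ : ℝ, 0 < c ∧ ∀ᶠ n : ℕ in Filter.atTop, |a n| ≤ c * Real.log n ^ γ * |b n|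

end LPAM

namespace LPAM

attribute [local instance] Classical.propDecidable

/-- Graphs on `Fin n` up to isomorphism. -/
def isoSetoid (n : ℕ) : Setoid (SimpleGraph (Fin n)) where
  r G H := Nonempty (G ≃g H)
  iseqv := ⟨fun G => ⟨SimpleGraph.Iso.refl⟩, fun ⟨e⟩ => ⟨e.symm⟩, fun ⟨e⟩ ⟨f⟩ => ⟨e.trans f⟩⟩

/-- The probability that the preferential attachment tree `T_n^{(S)}`, viewed up to graph
isomorphism, equals the isomorphism class `c`. -/
def isoLaw {n₀ : ℕ} (S : SimpleGraph (Fin n₀)) (n : ℕ) (c : Quotient (isoSetoid n)) : ℝ :=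
  ∑ G : SimpleGraph (Fin n), if Quotient.mk (isoSetoid n) G = c then lawAt S n G else 0

/-- The total variation distance between the laws of `T_n^{(S₁)}` and `T_n^{(S₂)}`, regarded as
random variables with values in isomorphism classes of graphs on `n` vertices. -/
def tvDist {n₁ n₂ : ℕ} (S₁ : SimpleGraph (Fin n₁)) (S₂ : SimpleGraph (Fin n₂)) (n : ℕ) : ℝ :=
  (1 / 2) * ∑ c : Quotient (isoSetoid n), |isoLaw S₁ n c - isoLaw S₂ n c|

/-! ### Attaching a vertex -/

section Attach

variable {n : ℕ} {G H : SimpleGraph (Fin n)} {v : Fin n}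

@[simp] lemma attach_adj_castSucc (a b : Fin n) :
    (attach G v).Adj a.castSucc b.castSucc ↔ G.Adj a b := by
  simp only [attach, SimpleGraph.fromRel_adj, ne_eq, Fin.castSucc_inj]
  constructor
  · rintro ⟨-, (⟨a', b', ha, hb, h⟩ | ⟨h, -⟩) | (⟨a', b', ha, hb, h⟩ | ⟨h, -⟩)⟩
    · exact ha ▸ hb ▸ h
    · exact absurd h (Fin.castSucc_lt_last a).ne
    · exact ha ▸ hb ▸ h.symm
    · exact absurd h (Fin.castSucc_lt_last b).ne
  · exact fun h => ⟨h.ne, Or.inl (Or.inl ⟨a, b, rfl, rfl, h⟩)⟩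

@[simp] lemma attach_adj_last_left (a : Fin n) :
    (attach G v).Adj (Fin.last n) a.castSucc ↔ a = v := by
  have hne : ∀ b : Fin n, Fin.last n ≠ b.castSucc := fun b => (Fin.castSucc_lt_last b).ne'
  simp [attach, SimpleGraph.fromRel_adj, hne]

@[simp] lemma attach_adj_last_right (a : Fin n) :
    (attach G v).Adj a.castSucc (Fin.last n) ↔ a = v := by
  rw [SimpleGraph.adj_comm, attach_adj_last_left]

lemma deg_attach_castSucc (w : Fin n) :
    deg (attach G v) w.castSucc = deg G w + if w = v then 1 else 0 := by
  have h : (attach G v).neighborSet w.castSucc =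
      Fin.castSucc '' G.neighborSet w ∪ if w = v then {Fin.last n} else ∅ := by
    ext x
    refine Fin.lastCases ?_ (fun y => ?_) x
    · split_ifs with hw <;> simp [hw, (Fin.castSucc_lt_last _).ne]
    · split_ifs with hw <;> simp [(Fin.castSucc_lt_last _).ne]
  rw [deg, h, Set.ncard_union_eq _ (Set.toFinite _) (Set.toFinite _),
    Set.ncard_image_of_injective _ (Fin.castSucc_injective n), deg]
  · split_ifs <;> simp
  · split_ifs <;> simp [(Fin.castSucc_lt_last _).ne]

lemma deg_attach_last : deg (attach G v) (Fin.last n) = 1 := by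
  have h : (attach G v).neighborSet (Fin.last n) = {v.castSucc} := by
    ext x
    refine Fin.lastCases ?_ (fun y => ?_) x
    · simp [(Fin.castSucc_lt_last _).ne']
    · simp
  rw [deg, h, Set.ncard_singleton]

lemma sum_deg_attach : ∑ w, deg (attach G v) w = ∑ w, deg G w + 2 := by
  simp [Fin.sum_univ_castSucc, deg_attach_castSucc, deg_attach_last, sum_add_distrib]

lemma sum_sq_deg_attach :
    ∑ w, deg (attach G v) w ^ 2 = ∑ w, deg G w ^ 2 + (2 * deg G v + 2) := by
  have h : ∀ w, (deg G w + if w = v then 1 else 0) ^ 2 =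
      deg G w ^ 2 + if w = v then 2 * deg G v + 1 else 0 := by
    intro w
    split_ifs with hw
    · subst hw; ring
    · ring
  simp only [Fin.sum_univ_castSucc, deg_attach_castSucc, deg_attach_last, h, sum_add_distrib,
    sum_ite_eq', mem_univ, if_true]
  ring

lemma deg_iso (e : G ≃g H) (w : Fin n) : deg H (e w) = deg G w := by
  have h : H.neighborSet (e w) = e '' G.neighborSet w := by
    ext x
    constructor
    · intro hx
      refine ⟨e.symm x, ?_, by simp⟩
      rw [SimpleGraph.mem_neighborSet, ← e.map_adj_iff]
      simpa using hx
    · rintro ⟨y, hy, rfl⟩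
      exact e.map_adj_iff.2 hy
  rw [deg, h, Set.ncard_image_of_injective _ e.injective, deg]

/-- An isomorphism extends to the graphs obtained by attaching a vertex at matching places. -/
lemma attach_iso (e : G ≃g H) (v : Fin n) : Nonempty (attach G v ≃g attach H (e v)) := by
  let E : Fin (n + 1) ≃ Fin (n + 1) :=
    finSuccEquivLast.trans ((Equiv.optionCongr e.toEquiv).trans finSuccEquivLast.symm)
  have hc : ∀ a : Fin n, E a.castSucc = (e a).castSucc := fun a => by simp [E]
  have hl : E (Fin.last n) = Fin.last n := by simp [E]
  refine ⟨⟨E, ?_⟩⟩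
  intro a b
  refine Fin.lastCases ?_ (fun a => ?_) a <;> refine Fin.lastCases ?_ (fun b => ?_) b
  · simp
  · rw [hl, hc, attach_adj_last_left, attach_adj_last_left, e.injective.eq_iff]
  · rw [hl, hc, attach_adj_last_right, attach_adj_last_right, e.injective.eq_iff]
  · rw [hc, hc, attach_adj_castSucc, attach_adj_castSucc, e.map_adj_iff]

end Attach

/-- A graph on `Fin n` has *tree-like degrees* if its degrees are positive and sum to
`2 * n - 2`. -/
def TreeDeg {n : ℕ} (G : SimpleGraph (Fin n)) : Prop :=
  (∀ v, 0 < deg G v) ∧ ∑ v, deg G v + 2 = 2 * n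

lemma TreeDeg.attach {n : ℕ} {G : SimpleGraph (Fin n)} (h : TreeDeg G) (v : Fin n) :
    TreeDeg (attach G v) := by
  refine ⟨fun w => ?_, ?_⟩
  · refine Fin.lastCases ?_ (fun w => ?_) w
    · simp [deg_attach_last]
    · rw [deg_attach_castSucc]
      exact Nat.add_pos_left (h.1 w) _
  · have := h.2
    rw [sum_deg_attach]
    lia

lemma TreeDeg.sum_cast {n : ℕ} {G : SimpleGraph (Fin n)} (h : TreeDeg G) :
    ∑ v, (deg G v : ℝ) = 2 * n - 2 := by
  have : ((∑ v, deg G v + 2 : ℕ) : ℝ) = (2 * n : ℕ) := by rw [h.2]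
  push_cast at this
  linarith

lemma TreeDeg.of_iso {n : ℕ} {G H : SimpleGraph (Fin n)} (e : G ≃g H) (h : TreeDeg G) :
    TreeDeg H := by
  have hs : ∑ v, deg H v = ∑ v, deg G v := by
    rw [← e.toEquiv.sum_comp]
    exact sum_congr rfl fun v _ => deg_iso e v
  refine ⟨fun v => ?_, hs ▸ h.2⟩
  have := h.1 (e.symm v)
  rwa [← deg_iso e, e.apply_symm_apply] at this

lemma deg_eq_degree {n : ℕ} (G : SimpleGraph (Fin n)) (v : Fin n) : deg G v = G.degree v := by
  rw [deg, ← Nat.card_coe_set_eq, Nat.card_eq_fintype_card,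
    SimpleGraph.card_neighborSet_eq_degree]

lemma _root_.SimpleGraph.IsTree.treeDeg {n : ℕ} {G : SimpleGraph (Fin n)} (h : G.IsTree)
    (hn : 2 ≤ n) : TreeDeg G := by
  refine ⟨fun v => ?_, ?_⟩
  · have : Nontrivial (Fin n) := Fin.nontrivial_iff_two_le.2 hn
    rw [deg_eq_degree]
    exact h.1.preconnected.degree_pos_of_nontrivial v
  · simp only [deg_eq_degree]
    rw [SimpleGraph.sum_degrees_eq_twice_card_edges]
    have := h.card_edgeFinset
    rw [Fintype.card_fin] at this
    lia

/-- A bijective homomorphism between graphs with equal degree sums is an isomorphism. -/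
lemma nonempty_iso_of_bijective_hom {n : ℕ} {G H : SimpleGraph (Fin n)}
    (h : ∑ v, deg G v = ∑ v, deg H v) (e : Fin n ≃ Fin n)
    (he : ∀ a b, G.Adj a b → H.Adj (e a) (e b)) : Nonempty (G ≃g H) := by
  have hsub : ∀ a, e '' G.neighborSet a ⊆ H.neighborSet (e a) := by
    rintro a _ ⟨b, hb, rfl⟩
    exact he a b hb
  have hle : ∀ a ∈ univ, deg G a ≤ deg H (e a) := fun a _ => by
    have := Set.ncard_le_ncard (hsub a) (Set.toFinite _)
    rwa [Set.ncard_image_of_injective _ e.injective] at this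
  have heq := (sum_eq_sum_iff_of_le hle).1 (h.trans (e.sum_comp _).symm)
  have hset : ∀ a, e '' G.neighborSet a = H.neighborSet (e a) := fun a =>
    Set.eq_of_subset_of_ncard_le (hsub a) (by
      rw [Set.ncard_image_of_injective _ e.injective]
      exact (heq a (mem_univ a)).ge) (Set.toFinite _)
  refine ⟨⟨e, ?_⟩⟩
  intro a b
  rw [← SimpleGraph.mem_neighborSet, ← hset, e.injective.mem_set_image, SimpleGraph.mem_neighborSet]

/-! ### Expectations -/

section Expectation

variable {n₀ : ℕ} {S : SimpleGraph (Fin n₀)}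

lemma lawAt_add (S : SimpleGraph (Fin n₀)) (k : ℕ) (G : SimpleGraph (Fin (n₀ + k))) :
    lawAt S (n₀ + k) G = law S k G := by
  have key : ∀ (j : ℕ) (_ : j = k)
      (h : SimpleGraph (Fin (n₀ + k)) = SimpleGraph (Fin (n₀ + j))),
      law S j (cast h G) = law S k G := by
    rintro j rfl h
    rfl
  rw [lawAt, dif_pos (Nat.le_add_right _ _)]
  exact key _ (Nat.add_sub_cancel_left _ _) _

lemma lawAt_self (S G : SimpleGraph (Fin n₀)) : lawAt S n₀ G = if G = S then 1 else 0 :=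
  lawAt_add S 0 G

lemma lawAt_succ {n : ℕ} (hn : n₀ ≤ n) (G : SimpleGraph (Fin (n + 1))) :
    lawAt S (n + 1) G = ∑ H : SimpleGraph (Fin n), ∑ v : Fin n,
      lawAt S n H * ((deg H v : ℝ) / (2 * n - 2)) * (if attach H v = G then 1 else 0) := by
  obtain ⟨k, rfl⟩ := Nat.exists_eq_add_of_le hn
  simp only [lawAt_add]
  exact (lawAt_add S (k + 1) G).trans rfl

lemma lawAt_nonneg (h₀ : 1 ≤ n₀) {n : ℕ} (hn : n₀ ≤ n) (G : SimpleGraph (Fin n)) :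
    0 ≤ lawAt S n G := by
  induction n, hn using Nat.le_induction with
  | base => rw [lawAt_self]; split_ifs <;> norm_num
  | succ n hn ih =>
    have h1 : (1 : ℝ) ≤ n := by exact_mod_cast h₀.trans hn
    rw [lawAt_succ hn]
    refine sum_nonneg fun H _ => sum_nonneg fun v _ => ?_
    refine mul_nonneg (mul_nonneg (ih H) (div_nonneg (by positivity) (by linarith))) ?_
    split_ifs <;> norm_num

lemma treeDeg_of_lawAt_ne_zero (hS : TreeDeg S) {n : ℕ} (hn : n₀ ≤ n) (G : SimpleGraph (Fin n))
    (hG : lawAt S n G ≠ 0) : TreeDeg G := by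
  induction n, hn using Nat.le_induction with
  | base =>
    rw [lawAt_self] at hG
    split_ifs at hG with h
    · exact h ▸ hS
    · exact absurd rfl hG
  | succ n hn ih =>
    rw [lawAt_succ hn] at hG
    obtain ⟨H, -, hH⟩ := exists_ne_zero_of_sum_ne_zero hG
    obtain ⟨v, -, hv⟩ := exists_ne_zero_of_sum_ne_zero hH
    have h : attach H v = G := by
      by_contra h
      simp [h] at hv
    rw [← h]
    refine (ih H ?_).attach v
    rintro h0
    simp [h0] at hv

/-- The expectation of `f` under the law of `T_n^{(S)}`. -/
def expect (S : SimpleGraph (Fin n₀)) (n : ℕ) (f : SimpleGraph (Fin n) → ℝ) : ℝ :=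
  ∑ G, lawAt S n G * f G

/-- The transition operator: the expectation of `f` after attaching a vertex to `G`. -/
def step (n : ℕ) (f : SimpleGraph (Fin (n + 1)) → ℝ) (G : SimpleGraph (Fin n)) : ℝ :=
  ∑ v, (deg G v : ℝ) / (2 * n - 2) * f (attach G v)

lemma expect_succ {n : ℕ} (hn : n₀ ≤ n) (f : SimpleGraph (Fin (n + 1)) → ℝ) :
    expect S (n + 1) f = expect S n (step n f) := by
  simp only [expect, lawAt_succ hn, step, sum_mul, mul_sum]
  rw [sum_comm]
  refine sum_congr rfl fun H _ => ?_
  rw [sum_comm]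
  refine sum_congr rfl fun v _ => ?_
  simp [mul_assoc]

lemma expect_congr (hS : TreeDeg S) {n : ℕ} (hn : n₀ ≤ n) {f g : SimpleGraph (Fin n) → ℝ}
    (h : ∀ G, TreeDeg G → f G = g G) : expect S n f = expect S n g := by
  refine sum_congr rfl fun G _ => ?_
  by_cases hG : lawAt S n G = 0
  · simp [hG]
  · rw [h G (treeDeg_of_lawAt_ne_zero hS hn G hG)]

lemma expect_mono (h₀ : 1 ≤ n₀) {n : ℕ} (hn : n₀ ≤ n) {f g : SimpleGraph (Fin n) → ℝ}
    (h : ∀ G, f G ≤ g G) : expect S n f ≤ expect S n g :=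
  sum_le_sum fun G _ => mul_le_mul_of_nonneg_left (h G) (lawAt_nonneg h₀ hn G)

lemma expect_add {n : ℕ} (f g : SimpleGraph (Fin n) → ℝ) :
    expect S n (fun G => f G + g G) = expect S n f + expect S n g := by
  simp [expect, mul_add, sum_add_distrib]

lemma expect_const_mul {n : ℕ} (c : ℝ) (f : SimpleGraph (Fin n) → ℝ) :
    expect S n (fun G => c * f G) = c * expect S n f := by
  simp only [expect, mul_sum]
  exact sum_congr rfl fun G _ => by ring

lemma expect_sum {n : ℕ} {ι : Type*} (s : Finset ι) (f : ι → SimpleGraph (Fin n) → ℝ) :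
    expect S n (fun G => ∑ i ∈ s, f i G) = ∑ i ∈ s, expect S n (f i) := by
  simp only [expect, mul_sum]
  exact sum_comm

lemma TreeDeg.step_one {n : ℕ} {G : SimpleGraph (Fin n)} (h : TreeDeg G) (hn : 2 ≤ n) :
    step n (fun _ => 1) G = 1 := by
  have h2 : (2 : ℝ) ≤ n := by exact_mod_cast hn
  rw [step]
  simp only [mul_one]
  rw [← sum_div, h.sum_cast, div_self (by linarith)]

lemma expect_one (hS : TreeDeg S) (h₀ : 2 ≤ n₀) {n : ℕ} (hn : n₀ ≤ n) :
    expect S n (fun _ => 1) = 1 := by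
  induction n, hn using Nat.le_induction with
  | base => simp [expect, lawAt_self]
  | succ n hn ih =>
    rw [expect_succ hn]
    exact (expect_congr hS hn fun G hG => hG.step_one (h₀.trans hn)).trans ih

end Expectation

/-! ### Isomorphism invariant functions -/

/-- A function on graphs is invariant if it takes equal values at isomorphic graphs. -/
def Invariant {n : ℕ} (f : SimpleGraph (Fin n) → ℝ) : Prop :=
  ∀ G H, Nonempty (G ≃g H) → f G = f H

lemma Invariant.step {n : ℕ} {f : SimpleGraph (Fin (n + 1)) → ℝ} (hf : Invariant f) :
    Invariant (step n f) := by
  rintro G H ⟨e⟩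
  symm
  rw [LPAM.step, LPAM.step, ← e.toEquiv.sum_comp]
  exact sum_congr rfl fun v _ => congrArg₂ (fun (a : ℕ) b => (a : ℝ) / (2 * n - 2) * b)
    (deg_iso e v) (hf _ _ (attach_iso e v)).symm

lemma Invariant.apply_out {n : ℕ} {f : SimpleGraph (Fin n) → ℝ} (hf : Invariant f)
    (G : SimpleGraph (Fin n)) : f (Quotient.mk (isoSetoid n) G).out = f G :=
  hf _ _ (Quotient.mk_out (s := isoSetoid n) G)

lemma invariant_indicator {n : ℕ} (c : Quotient (isoSetoid n)) :
    Invariant fun G : SimpleGraph (Fin n) =>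
      if Quotient.mk (isoSetoid n) G = c then (1 : ℝ) else 0 := by
  intro G H h
  have : Quotient.mk (isoSetoid n) G = Quotient.mk (isoSetoid n) H := Quotient.sound h
  simp only [this]

section IsoLaw

variable {n₀ : ℕ} {S : SimpleGraph (Fin n₀)}

lemma isoLaw_eq_expect (S : SimpleGraph (Fin n₀)) (n : ℕ) (c : Quotient (isoSetoid n)) :
    isoLaw S n c = expect S n fun G => if Quotient.mk (isoSetoid n) G = c then 1 else 0 := by
  simp [isoLaw, expect]

lemma expect_eq_sum_isoLaw {n : ℕ} {f : SimpleGraph (Fin n) → ℝ} (hf : Invariant f) :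
    expect S n f = ∑ c, isoLaw S n c * f c.out := by
  simp only [isoLaw, sum_mul]
  rw [sum_comm]
  refine sum_congr rfl fun G _ => ?_
  simp [ite_mul, hf.apply_out]

lemma isoLaw_nonneg (h₀ : 1 ≤ n₀) {n : ℕ} (hn : n₀ ≤ n) (c : Quotient (isoSetoid n)) :
    0 ≤ isoLaw S n c :=
  sum_nonneg fun G _ => by
    split_ifs
    exacts [lawAt_nonneg h₀ hn G, le_rfl]

lemma lawAt_le_isoLaw (h₀ : 1 ≤ n₀) {n : ℕ} (hn : n₀ ≤ n) (G : SimpleGraph (Fin n)) :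
    lawAt S n G ≤ isoLaw S n (Quotient.mk (isoSetoid n) G) := by
  have h := single_le_sum (f := fun H : SimpleGraph (Fin n) =>
    if Quotient.mk (isoSetoid n) H = Quotient.mk (isoSetoid n) G then lawAt S n H else 0)
    (fun H _ => by
      split_ifs
      exacts [lawAt_nonneg h₀ hn H, le_rfl]) (mem_univ G)
  simpa [isoLaw] using h

lemma treeDeg_out_of_isoLaw_ne_zero (hS : TreeDeg S) {n : ℕ} (hn : n₀ ≤ n)
    {c : Quotient (isoSetoid n)} (hc : isoLaw S n c ≠ 0) : TreeDeg c.out := by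
  obtain ⟨G, -, hG⟩ := exists_ne_zero_of_sum_ne_zero hc
  split_ifs at hG with h
  · obtain ⟨e⟩ : Nonempty (G ≃g c.out) :=
      Quotient.exact (s := isoSetoid n) (h.trans c.out_eq.symm)
    exact (treeDeg_of_lawAt_ne_zero hS hn G hG).of_iso e
  · exact absurd rfl hG

lemma isoLaw_self (S : SimpleGraph (Fin n₀)) (c : Quotient (isoSetoid n₀)) :
    isoLaw S n₀ c = if Quotient.mk (isoSetoid n₀) S = c then 1 else 0 := by
  simp [isoLaw_eq_expect, expect, lawAt_self, -mul_ite]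

end IsoLaw

/-! ### Total variation distance -/

section TotalVariation

variable {n₁ n₂ : ℕ} {S₁ : SimpleGraph (Fin n₁)} {S₂ : SimpleGraph (Fin n₂)}

lemma tvDist_comm (S₁ : SimpleGraph (Fin n₁)) (S₂ : SimpleGraph (Fin n₂)) (n : ℕ) :
    tvDist S₁ S₂ n = tvDist S₂ S₁ n := by
  simp only [tvDist, abs_sub_comm]

lemma tvDist_nonneg (S₁ : SimpleGraph (Fin n₁)) (S₂ : SimpleGraph (Fin n₂)) (n : ℕ) :
    0 ≤ tvDist S₁ S₂ n :=
  mul_nonneg (by norm_num) (sum_nonneg fun _ _ => abs_nonneg _)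

lemma tvDist_succ_le (h₁ : TreeDeg S₁) (h₂ : TreeDeg S₂) {n : ℕ} (hn : 2 ≤ n) (hn₁ : n₁ ≤ n)
    (hn₂ : n₂ ≤ n) : tvDist S₁ S₂ (n + 1) ≤ tvDist S₁ S₂ n := by
  have h2 : (2 : ℝ) ≤ n := by exact_mod_cast hn
  let q : SimpleGraph (Fin n) → Quotient (isoSetoid (n + 1)) → ℝ := fun G c =>
    step n (fun H => if Quotient.mk (isoSetoid (n + 1)) H = c then 1 else 0) G
  have hq0 : ∀ G c, 0 ≤ q G c := fun G c => sum_nonneg fun v _ =>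
    mul_nonneg (div_nonneg (by positivity) (by linarith)) (by dsimp only; split_ifs <;> norm_num)
  have hq1 : ∀ G, ∑ c, q G c = step n (fun _ => 1) G := by
    intro G
    simp only [q, step]
    rw [sum_comm]
    simp
  have hrec : ∀ {m : ℕ} (S : SimpleGraph (Fin m)) (_ : m ≤ n) (c : Quotient (isoSetoid (n + 1))),
      isoLaw S (n + 1) c = ∑ b, isoLaw S n b * q b.out c := by
    intro m S hm c
    rw [isoLaw_eq_expect, expect_succ hm, expect_eq_sum_isoLaw (invariant_indicator c).step]
  have hle : ∀ c, |isoLaw S₁ (n + 1) c - isoLaw S₂ (n + 1) c| ≤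
      ∑ b, |isoLaw S₁ n b - isoLaw S₂ n b| * q b.out c := by
    intro c
    rw [hrec S₁ hn₁, hrec S₂ hn₂, ← sum_sub_distrib]
    refine (abs_sum_le_sum_abs _ _).trans (sum_le_sum fun b _ => ?_)
    rw [← sub_mul, abs_mul, abs_of_nonneg (hq0 _ _)]
  refine mul_le_mul_of_nonneg_left ((sum_le_sum fun c _ => hle c).trans ?_) (by norm_num)
  rw [sum_comm]
  refine sum_le_sum fun b _ => ?_
  rw [← mul_sum, hq1]
  by_cases hb : isoLaw S₁ n b - isoLaw S₂ n b = 0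
  · simp [hb]
  · have hT : TreeDeg b.out := by
      by_cases hb1 : isoLaw S₁ n b = 0
      · refine treeDeg_out_of_isoLaw_ne_zero h₂ hn₂ fun hb2 => hb ?_
        rw [hb1, hb2, sub_zero]
      · exact treeDeg_out_of_isoLaw_ne_zero h₁ hn₁ hb1
    rw [hT.step_one hn, mul_one]

/-- Second moment lower bound on the total variation distance. -/
lemma sq_expect_sub_le (h₁ : 1 ≤ n₁) (h₂ : 1 ≤ n₂) {n : ℕ} (hn₁ : n₁ ≤ n)
    (hn₂ : n₂ ≤ n) {f : SimpleGraph (Fin n) → ℝ} (hf : Invariant f) :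
    (expect S₁ n f - expect S₂ n f) ^ 2 ≤
      2 * tvDist S₁ S₂ n * (expect S₁ n (fun G => f G ^ 2) + expect S₂ n (fun G => f G ^ 2)) := by
  have hf2 : Invariant fun G => f G ^ 2 := fun G H h => by simp only [hf G H h]
  rw [expect_eq_sum_isoLaw hf, expect_eq_sum_isoLaw hf, expect_eq_sum_isoLaw hf2,
    expect_eq_sum_isoLaw hf2, ← sum_sub_distrib, ← sum_add_distrib, tvDist, ← mul_assoc]
  norm_num only [one_mul]
  have hcs := sum_sq_le_sum_mul_sum_of_sq_le_mul univ
    (r := fun c => isoLaw S₁ n c * f c.out - isoLaw S₂ n c * f c.out)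
    (f := fun c => |isoLaw S₁ n c - isoLaw S₂ n c|)
    (g := fun c => |isoLaw S₁ n c - isoLaw S₂ n c| * f c.out ^ 2)
    (fun c _ => abs_nonneg _) (fun c _ => by positivity) (fun c _ => by
      rw [← mul_assoc, abs_mul_abs_self, ← sub_mul, mul_pow, sq (_ - _)])
  refine hcs.trans (mul_le_mul_of_nonneg_left (sum_le_sum fun c _ => ?_)
    (sum_nonneg fun c _ => abs_nonneg _))
  rw [← add_mul]
  refine mul_le_mul_of_nonneg_right ?_ (sq_nonneg _)
  have p1 := isoLaw_nonneg (S := S₁) h₁ hn₁ c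
  have p2 := isoLaw_nonneg (S := S₂) h₂ hn₂ c
  rw [abs_le]
  constructor <;> linarith

end TotalVariation

/-! ### Products of rising factorials of degrees -/

/-- The product of the rising factorials `(deg v)^{(κ v)}` over the vertices `v` of `G`. -/
def wt {n : ℕ} (G : SimpleGraph (Fin n)) (κ : Fin n → ℕ) : ℝ :=
  ∏ v, ((deg G v).ascFactorial (κ v) : ℝ)

section Weight

variable {n : ℕ} {G : SimpleGraph (Fin n)}

lemma wt_nonneg (κ : Fin n → ℕ) : 0 ≤ wt G κ := prod_nonneg fun _ _ => by positivity

lemma wt_pos (hG : TreeDeg G) (κ : Fin n → ℕ) : 0 < wt G κ :=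
  prod_pos fun v _ => by
    obtain ⟨d, hd⟩ := Nat.exists_eq_succ_of_ne_zero (hG.1 v).ne'
    rw [hd]
    exact_mod_cast Nat.ascFactorial_pos d (κ v)

lemma wt_mul_le (κ κ' : Fin n → ℕ) : wt G κ * wt G κ' ≤ wt G fun v => κ v + κ' v := by
  rw [wt, wt, wt, ← prod_mul_distrib]
  refine prod_le_prod (fun v _ => by positivity) fun v _ => ?_
  rw [← Nat.ascFactorial_mul_ascFactorial]
  exact_mod_cast Nat.mul_le_mul_left _ (Nat.ascFactorial_le _ (Nat.le_add_right _ _))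

lemma wt_iso {H : SimpleGraph (Fin n)} (e : G ≃g H) (κ : Fin n → ℕ) :
    wt H (κ ∘ e.symm) = wt G κ := by
  rw [wt, wt, ← e.toEquiv.prod_comp]
  refine prod_congr rfl fun v _ => ?_
  have h1 : deg H (e.toEquiv v) = deg G v := deg_iso e v
  have h2 : e.symm (e.toEquiv v) = v := e.symm_apply_apply v
  rw [Function.comp_apply, h1, h2]

lemma deg_add_mul_wt (v : Fin n) (κ : Fin n → ℕ) :
    (deg G v + κ v : ℝ) * wt G κ = wt G fun w => κ w + if w = v then 1 else 0 := by
  rw [wt, wt, ← mul_prod_erase univ _ (mem_univ v), ← mul_prod_erase univ _ (mem_univ v),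
    ← mul_assoc]
  congr 1
  · rw [if_pos rfl, Nat.ascFactorial_succ]
    push_cast
    ring
  · refine prod_congr rfl fun w hw => ?_
    rw [if_neg (ne_of_mem_erase hw), add_zero]

lemma deg_mul_wt_attach (v : Fin n) (κ : Fin (n + 1) → ℕ) :
    (deg G v : ℝ) * wt (attach G v) κ =
      (κ (Fin.last n)).factorial *
        ((deg G v + κ v.castSucc : ℝ) * wt G fun w => κ w.castSucc) := by
  rw [wt, wt, Fin.prod_univ_castSucc, deg_attach_last, Nat.one_ascFactorial,
    ← mul_prod_erase univ _ (mem_univ v),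
    ← mul_prod_erase univ (fun w => ((deg G w).ascFactorial (κ w.castSucc) : ℝ)) (mem_univ v)]
  have h1 : (deg G v : ℝ) * ((deg (attach G v) v.castSucc).ascFactorial (κ v.castSucc) : ℕ) =
      (deg G v + κ v.castSucc) * ((deg G v).ascFactorial (κ v.castSucc) : ℕ) := by
    rw [deg_attach_castSucc, if_pos rfl]
    exact_mod_cast Nat.succ_ascFactorial (deg G v) (κ v.castSucc)
  have h2 : ∏ w ∈ univ.erase v, ((deg (attach G v) w.castSucc).ascFactorial (κ w.castSucc) : ℝ) =
      ∏ w ∈ univ.erase v, ((deg G w).ascFactorial (κ w.castSucc) : ℝ) :=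
    prod_congr rfl fun w hw => by
      rw [deg_attach_castSucc, if_neg (ne_of_mem_erase hw), add_zero]
  rw [h2, ← mul_assoc, ← mul_assoc, h1]
  ring

/-- The transition operator applied to a weighted sum over labellings of the vertices. -/
lemma sum_deg_mul_sum_wt_attach {X : Type*} [Fintype X] (w : X → ℕ)
    (c : Fin n → (Fin (n + 1) → X) → ℝ) :
    ∑ v, (deg G v : ℝ) * ∑ g : Fin (n + 1) → X, c v g * wt (attach G v) (fun a => w (g a)) =
      ∑ x, ((w x).factorial : ℝ) * ∑ g : Fin n → X, ∑ v,
        c v (Fin.snoc (α := fun _ => X) g x) *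
          ((deg G v + w (g v) : ℝ) * wt G fun a => w (g a)) := by
  have h : ∀ v, (deg G v : ℝ) * ∑ g : Fin (n + 1) → X, c v g * wt (attach G v) (fun a => w (g a)) =
      ∑ x, ∑ g : Fin n → X, c v (Fin.snoc (α := fun _ => X) g x) * ((w x).factorial *
          ((deg G v + w (g v) : ℝ) * wt G fun a => w (g a))) := by
    intro v
    rw [mul_sum, ← (Fin.snocEquiv fun _ => X).sum_comp, Fintype.sum_prod_type]
    refine sum_congr rfl fun x _ => sum_congr rfl fun g _ => ?_
    rw [mul_left_comm, deg_mul_wt_attach]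
    simp [Fin.snocEquiv]
  simp only [h, mul_sum]
  rw [sum_comm]
  refine sum_congr rfl fun x _ => ?_
  rw [sum_comm]
  exact sum_congr rfl fun g _ => sum_congr rfl fun v _ => by ring

lemma TreeDeg.sum_deg_add_mul_wt (hG : TreeDeg G) (κ : Fin n → ℕ) (b : ℝ) :
    ∑ v, (deg G v + κ v : ℝ) * b = (2 * n - 2 + (∑ v, κ v : ℕ)) * b := by
  rw [← sum_mul, sum_add_distrib, hG.sum_cast]
  push_cast
  rfl

end Weight

/-! ### Moment bounds -/

/-- The product of the growth factors `1 + x / (2 m - 2)` for `N ≤ m < n`. -/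
def growth (N : ℕ) (x : ℝ) (n : ℕ) : ℝ := ∏ m ∈ Ico N n, (1 + x / (2 * m - 2))

section Growth

variable {N : ℕ} {x : ℝ}

lemma growth_self : growth N x N = 1 := by simp [growth]

lemma growth_succ {n : ℕ} (hn : N ≤ n) :
    growth N x (n + 1) = growth N x n * (1 + x / (2 * n - 2)) :=
  prod_Ico_succ_top hn _

lemma growth_factor_pos (hx : -3 ≤ x) {m : ℕ} (hm : 3 ≤ m) : 0 < 1 + x / (2 * m - 2) := by
  have h3 : (3 : ℝ) ≤ m := by exact_mod_cast hm
  have h : (0 : ℝ) < 2 * m - 2 := by linarith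
  rw [← neg_lt_iff_pos_add', lt_div_iff₀ h]
  linarith

lemma growth_pos (hN : 3 ≤ N) (hx : -3 ≤ x) (n : ℕ) : 0 < growth N x n :=
  prod_pos fun _ hm => growth_factor_pos hx (hN.trans (mem_Ico.1 hm).1)

lemma growth_mono (hN : 3 ≤ N) {y : ℝ} (hx : -3 ≤ x) (hxy : x ≤ y) (n : ℕ) :
    growth N x n ≤ growth N y n := by
  refine prod_le_prod (fun m hm => (growth_factor_pos hx (hN.trans (mem_Ico.1 hm).1)).le)
    fun m hm => ?_
  have h3 : (3 : ℝ) ≤ m := by exact_mod_cast hN.trans (mem_Ico.1 hm).1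
  have h : (0 : ℝ) < 2 * m - 2 := by linarith
  gcongr

lemma growth_two_mul_le (hN : 3 ≤ N) (hx : 0 ≤ x) (n : ℕ) :
    growth N (2 * x) n ≤ growth N x n ^ 2 := by
  rw [growth, growth, ← prod_pow]
  refine prod_le_prod (fun m hm => (growth_factor_pos (by linarith)
    (hN.trans (mem_Ico.1 hm).1)).le) fun m _ => ?_
  have := sq_nonneg (x / (2 * m - 2))
  rw [mul_div_assoc]
  nlinarith

/-- A discrete Grönwall estimate: a source term growing with a smaller exponent does not change
the order of growth. -/
lemma exists_le_growth (hN : 3 ≤ N) (hx : 0 ≤ x) {a : ℕ → ℝ} {C : ℝ} (hC : 0 ≤ C)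
    (h : ∀ᶠ n : ℕ in Filter.atTop,
      a (n + 1) ≤ (1 + x / (2 * n - 2)) * a n + C * growth N (x - 3) n) :
    ∃ A, ∀ᶠ n in Filter.atTop, a n ≤ A * growth N x n := by
  obtain ⟨M, hM⟩ := Filter.eventually_atTop.1 h
  obtain ⟨k, hk⟩ := exists_nat_ge (2 * x)
  set s := max (max M N) (k + 1) with hs
  have hMs : M ≤ s := (le_max_left _ _).trans (le_max_left _ _)
  have hNs : N ≤ s := (le_max_right _ _).trans (le_max_left _ _)
  have hks : k + 1 ≤ s := le_max_right _ _
  have hq := growth_pos hN (show (-3 : ℝ) ≤ x - 3 by linarith)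
  have hp := growth_pos hN (show (-3 : ℝ) ≤ x by linarith)
  refine ⟨(a s + 4 * C * (s - 1) * growth N (x - 3) s) / growth N x s,
    Filter.eventually_atTop.2 ⟨s, fun n hn => ?_⟩⟩
  set A := (a s + 4 * C * (s - 1) * growth N (x - 3) s) / growth N x s with hA
  suffices hle : a n ≤ A * growth N x n - 4 * C * (n - 1) * growth N (x - 3) n by
    have h3 : (3 : ℝ) ≤ n := by exact_mod_cast hN.trans (hNs.trans hn)
    have : 0 ≤ 4 * C * (n - 1) * growth N (x - 3) n :=
      mul_nonneg (mul_nonneg (by linarith) (by linarith)) (hq n).le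
    linarith
  induction n, hn using Nat.le_induction with
  | base =>
    rw [hA, div_mul_cancel₀ _ (hp s).ne']
    linarith
  | succ n hn ih =>
    have h3 : (3 : ℝ) ≤ n := by exact_mod_cast hN.trans (hNs.trans hn)
    have hkn : (k : ℝ) + 1 ≤ n := by exact_mod_cast hks.trans hn
    obtain ⟨t, ht⟩ : ∃ t : ℝ, (n : ℝ) = t + 1 := ⟨n - 1, by ring⟩
    have ht0 : 0 < t := by linarith
    have hxt : (x - 3) / t ≤ 1 / 2 := by
      rw [div_le_iff₀ ht0]
      linarith
    refine (hM n (hMs.trans hn)).trans ?_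
    rw [growth_succ (hNs.trans hn), growth_succ (hNs.trans hn)]
    have hstep := mul_le_mul_of_nonneg_left ih
      (growth_factor_pos (show (-3 : ℝ) ≤ x by linarith) (hN.trans (hNs.trans hn))).le
    have hkey : 0 ≤ C * growth N (x - 3) n * (1 - 2 * ((x - 3) / t)) :=
      mul_nonneg (mul_nonneg hC (hq n).le) (by linarith)
    push_cast
    rw [ht] at hstep ⊢
    have e : (2 * (t + 1) - 2 : ℝ) = 2 * t := by ring
    rw [e] at hstep ⊢
    have e1 : (1 + x / (2 * t)) * (A * growth N x n - 4 * C * (t + 1 - 1) * growth N (x - 3) n)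
        + C * growth N (x - 3) n + C * growth N (x - 3) n * (1 - 2 * ((x - 3) / t)) =
        A * (growth N x n * (1 + x / (2 * t))) -
          4 * C * (t + 1 + 1 - 1) * (growth N (x - 3) n * (1 + (x - 3) / (2 * t))) := by
      field_simp
      ring
    linarith

end Growth

/-- The sum, over labellings of the vertices of `G` with total weight `K`, of the associated
products of rising factorials of degrees. -/
def momentSum {X : Type*} [Fintype X] (w : X → ℕ) (K : ℕ) {n : ℕ} (G : SimpleGraph (Fin n)) : ℝ :=
  ∑ g : Fin n → X, if ∑ v, w (g v) = K then wt G fun v => w (g v) else 0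

section MomentSum

variable {X : Type*} [Fintype X] (w : X → ℕ)

lemma step_momentSum (K : ℕ) {n : ℕ} (hn : 2 ≤ n) {G : SimpleGraph (Fin n)} (hG : TreeDeg G) :
    step n (momentSum w K) G = ∑ x, if w x ≤ K then
      ((w x).factorial * (1 + ((K - w x : ℕ) : ℝ) / (2 * n - 2))) * momentSum w (K - w x) G
      else 0 := by
  have h2 : (2 : ℝ) ≤ n := by exact_mod_cast hn
  have hne : (2 * n - 2 : ℝ) ≠ 0 := by linarith
  have key := sum_deg_mul_sum_wt_attach (G := G) w
    (fun _ g => if ∑ v, w (g v) = K then (1 : ℝ) else 0)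
  have h1 : step n (momentSum w K) G = (∑ v, (deg G v : ℝ) * ∑ g : Fin (n + 1) → X,
      (if ∑ v, w (g v) = K then (1 : ℝ) else 0) * wt (attach G v) fun a => w (g a)) /
        (2 * n - 2) := by
    rw [step, sum_div]
    refine sum_congr rfl fun v _ => ?_
    simp only [momentSum, ite_mul, one_mul, zero_mul]
    ring
  rw [h1, key, sum_div]
  refine sum_congr rfl fun x _ => ?_
  have h3 : ∀ g : Fin n → X, ∑ v, (if ∑ a, w (Fin.snoc (α := fun _ => X) g x a) = K
      then (1 : ℝ) else 0) * ((deg G v + w (g v) : ℝ) * wt G fun a => w (g a)) =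
      if ∑ v, w (g v) + w x = K then (2 * n - 2 + (∑ v, w (g v) : ℕ)) * wt G fun a => w (g a)
        else 0 := by
    intro g
    rw [← mul_sum, hG.sum_deg_add_mul_wt fun v => w (g v)]
    simp [Fin.sum_univ_castSucc]
  rw [sum_congr rfl fun g _ => h3 g]
  split_ifs with hx
  · rw [momentSum, mul_sum, mul_sum, sum_div]
    refine sum_congr rfl fun g _ => ?_
    by_cases hg : ∑ v, w (g v) + w x = K
    · have hg' : ∑ v, w (g v) = K - w x := by lia
      rw [if_pos hg, if_pos hg', hg']
      generalize (2 * n - 2 : ℝ) = D at hne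
      field_simp
    · have hg' : ¬ ∑ v, w (g v) = K - w x := by lia
      simp [hg, hg']
  · rw [sum_eq_zero fun g _ => if_neg (by lia)]
    simp

variable {w} {n₀ : ℕ} {S : SimpleGraph (Fin n₀)}

/-- Moments of products of rising factorials of at least third order are of the order of the
corresponding growth factor. -/
lemma exists_expect_momentSum_le (hS : TreeDeg S) {N : ℕ} (hN : 3 ≤ N) {x₀ : X} (h₀ : w x₀ = 0)
    (hw : ∀ x, x ≠ x₀ → 3 ≤ w x) (K : ℕ) :
    ∃ A, ∀ᶠ n in Filter.atTop, expect S n (momentSum w K) ≤ A * growth N K n := by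
  induction K using Nat.strong_induction_on with
  | _ K ih =>
  have hterm : ∀ x, ∃ C : ℝ, 0 ≤ C ∧ (x ≠ x₀ → ∀ᶠ n in Filter.atTop,
      (if w x ≤ K then ((w x).factorial * (1 + ((K - w x : ℕ) : ℝ) / (2 * n - 2))) *
        expect S n (momentSum w (K - w x)) else 0) ≤ C * growth N (K - 3) n) := by
    intro x
    have hx3 : (-3 : ℝ) ≤ K - 3 := by linarith [(K.cast_nonneg : (0 : ℝ) ≤ K)]
    by_cases hx : x ≠ x₀ ∧ w x ≤ K
    · have hwx := hw x hx.1
      obtain ⟨A, hA⟩ := ih (K - w x) (by lia)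
      refine ⟨(w x).factorial * (1 + K) * |A|, by positivity, fun _ => ?_⟩
      filter_upwards [hA, Filter.eventually_ge_atTop 3] with n hn hn3
      rw [if_pos hx.2]
      have h3 : (3 : ℝ) ≤ n := by exact_mod_cast hn3
      have hcast : ((K - w x : ℕ) : ℝ) ≤ K := by exact_mod_cast Nat.sub_le _ _
      have hcast' : ((K - w x : ℕ) : ℝ) ≤ K - 3 := by
        have : K - w x + 3 ≤ K := by lia
        have : ((K - w x : ℕ) : ℝ) + 3 ≤ K := by exact_mod_cast this
        linarith
      have hnn : (0 : ℝ) ≤ ((K - w x : ℕ) : ℝ) := Nat.cast_nonneg _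
      have hg0 := growth_pos hN (show (-3 : ℝ) ≤ ((K - w x : ℕ) : ℝ) by linarith) n
      have hE : expect S n (momentSum w (K - w x)) ≤ |A| * growth N (K - 3) n := by
        refine hn.trans ((mul_le_mul_of_nonneg_right (le_abs_self A) hg0.le).trans ?_)
        exact mul_le_mul_of_nonneg_left (growth_mono hN (by linarith) hcast' n) (abs_nonneg A)
      have hdiv : ((K - w x : ℕ) : ℝ) / (2 * n - 2) ≤ K := by
        rw [div_le_iff₀ (by linarith)]
        nlinarith
      have hdiv0 : 0 ≤ ((K - w x : ℕ) : ℝ) / (2 * n - 2) := div_nonneg hnn (by linarith)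
      have hgK := growth_pos hN hx3 n
      calc _ ≤ ((w x).factorial * (1 + ((K - w x : ℕ) : ℝ) / (2 * n - 2))) *
            (|A| * growth N (K - 3) n) := mul_le_mul_of_nonneg_left hE (by positivity)
        _ ≤ ((w x).factorial * (1 + K)) * (|A| * growth N (K - 3) n) := by gcongr
        _ = _ := by ring
    · refine ⟨0, le_rfl, fun hx0 => Filter.Eventually.of_forall fun n => ?_⟩
      rw [if_neg fun h => hx ⟨hx0, h⟩, zero_mul]
  choose C hC0 hC using hterm
  refine exists_le_growth hN (Nat.cast_nonneg K) (sum_nonneg fun x (_ : x ∈ univ.erase x₀) => hC0 x)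
    ?_
  have hall : ∀ᶠ n in Filter.atTop, ∀ x ∈ univ.erase x₀,
      (if w x ≤ K then ((w x).factorial * (1 + ((K - w x : ℕ) : ℝ) / (2 * n - 2))) *
        expect S n (momentSum w (K - w x)) else 0) ≤ C x * growth N (K - 3) n :=
    (Filter.eventually_all_finset _).2 fun x hx => hC x (ne_of_mem_erase hx)
  filter_upwards [hall, Filter.eventually_ge_atTop n₀, Filter.eventually_ge_atTop 2]
    with n hn hn₀ hn2
  rw [expect_succ hn₀, expect_congr hS hn₀ fun G hG => step_momentSum w K hn2 hG, expect_sum,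
    ← add_sum_erase _ _ (mem_univ x₀), sum_mul]
  refine add_le_add (le_of_eq ?_) (sum_le_sum fun x hx => ?_)
  · simp only [h₀, Nat.zero_le, if_true, Nat.sub_zero, Nat.factorial_zero, Nat.cast_one, one_mul]
    exact expect_const_mul _ _
  · refine le_trans (le_of_eq ?_) (hn x hx)
    split_ifs
    · exact expect_const_mul _ _
    · simp [expect]

end MomentSum

/-! ### Decorated embeddings -/

section Embedding

variable {α : Type*} (τ : SimpleGraph α)

/-- The partial labelling `g` of the vertices of `G` is the inverse of an injective homomorphism
to `G` from the subgraph of `τ` induced by `A`. -/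
def IsEmb (A : Finset α) {n : ℕ} (G : SimpleGraph (Fin n)) (g : Fin n → Option α) : Prop :=
  (∀ u, u ∈ A ↔ ∃ v, g v = some u) ∧
  (∀ u v w, g v = some u → g w = some u → v = w) ∧
  (∀ u t v w, g v = some u → g w = some t → τ.Adj u t → G.Adj v w)

/-- The extension of the label `k` by zero to the missing label. -/
def optLabel (k : α → ℕ) (o : Option α) : ℕ := o.elim 0 k

@[simp] lemma optLabel_none (k : α → ℕ) : optLabel k none = 0 := rfl

@[simp] lemma optLabel_some (k : α → ℕ) (u : α) : optLabel k (some u) = k u := rfl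

/-- The number of embeddings in `G` of the subgraph of `τ` induced by `A`, weighted by rising
factorials of the degrees. -/
def embSum [Fintype α] (A : Finset α) (k : α → ℕ) {n : ℕ} (G : SimpleGraph (Fin n)) : ℝ :=
  ∑ g : Fin n → Option α, if IsEmb τ A G g then wt G fun v => optLabel k (g v) else 0

variable {τ} {A : Finset α} {n : ℕ} {G : SimpleGraph (Fin n)}

lemma IsEmb.sum_optLabel {g : Fin n → Option α} (h : IsEmb τ A G g) (k : α → ℕ) :
    ∑ v, optLabel k (g v) = ∑ u ∈ A, k u := by
  have h1 : ∀ v, optLabel k (g v) = ∑ u ∈ A, if g v = some u then k u else 0 := by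
    intro v
    cases hv : g v with
    | none => simp
    | some u => simp [(h.1 u).2 ⟨v, hv⟩]
  rw [sum_congr rfl fun v _ => h1 v, sum_comm]
  refine sum_congr rfl fun u hu => ?_
  obtain ⟨v, hv⟩ := (h.1 u).1 hu
  rw [sum_eq_single v (fun v' _ hne => if_neg fun hv' => hne (h.2.1 u v' v hv' hv)) (by simp),
    if_pos hv]

lemma isEmb_snoc_none {v : Fin n} {g : Fin n → Option α} :
    IsEmb τ A (attach G v) (Fin.snoc (α := fun _ => Option α) g none) ↔ IsEmb τ A G g := by
  simp [IsEmb, Fin.forall_fin_succ', Fin.exists_fin_succ']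

lemma isEmb_snoc_some {v : Fin n} {g : Fin n → Option α} {u : α} :
    IsEmb τ A (attach G v) (Fin.snoc (α := fun _ => Option α) g (some u)) ↔
      u ∈ A ∧ IsEmb τ (A.erase u) G g ∧ ∀ u' ∈ A.erase u, τ.Adj u u' → g v = some u' := by
  constructor
  · rintro ⟨h1, h2, h3⟩
    have hne : ∀ a, g a ≠ some u := fun a ha => by
      have := h2 u a.castSucc (Fin.last n) (by simpa using ha) (by simp)
      exact (Fin.castSucc_lt_last a).ne this
    refine ⟨(h1 u).2 ⟨Fin.last n, by simp⟩, ⟨fun u' => ?_, fun u' a b ha hb => ?_,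
      fun u' u'' a b ha hb hadj => ?_⟩, fun u' hu' hadj => ?_⟩
    · rw [mem_erase, h1, Fin.exists_fin_succ']
      constructor
      · rintro ⟨hu, ⟨a, ha⟩ | ha⟩
        · exact ⟨a, by simpa using ha⟩
        · simp only [Fin.snoc_last, Option.some.injEq] at ha
          exact absurd ha.symm hu
      · rintro ⟨a, ha⟩
        exact ⟨fun h => hne a (h ▸ ha), Or.inl ⟨a, by simpa using ha⟩⟩
    · exact Fin.castSucc_injective n (h2 u' _ _ (by simpa using ha) (by simpa using hb))
    · simpa using h3 u' u'' a.castSucc b.castSucc (by simpa using ha) (by simpa using hb) hadj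
    · obtain ⟨hu, hA⟩ := mem_erase.1 hu'
      obtain ⟨a, ha⟩ | ha := Fin.exists_fin_succ'.1 ((h1 u').1 hA)
      · rw [Fin.snoc_castSucc] at ha
        have := h3 u u' (Fin.last n) a.castSucc (by simp) (by simpa using ha) hadj
        rw [attach_adj_last_left] at this
        exact this ▸ ha
      · simp only [Fin.snoc_last, Option.some.injEq] at ha
        exact absurd ha.symm hu
  · rintro ⟨hu, ⟨h1, h2, h3⟩, h4⟩
    have hmem : ∀ {a u'}, g a = some u' → u' ∈ A.erase u := fun ha => (h1 _).2 ⟨_, ha⟩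
    refine ⟨fun u' => ?_, fun u' => ?_, fun u' u'' => ?_⟩
    · rw [Fin.exists_fin_succ']
      simp only [Fin.snoc_castSucc, Fin.snoc_last, Option.some.injEq, ← h1, mem_erase]
      by_cases h : u = u'
      · simp [← h, hu]
      · simp [h, Ne.symm h]
    · simp only [Fin.forall_fin_succ', Fin.snoc_castSucc, Fin.snoc_last, Option.some.injEq,
        Fin.castSucc_inj]
      refine ⟨fun a => ⟨fun b => h2 u' a b, fun ha h => ?_⟩, fun a h ha => ?_, fun _ _ => trivial⟩
      · exact absurd h.symm (mem_erase.1 (hmem ha)).1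
      · exact absurd h.symm (mem_erase.1 (hmem ha)).1
    · simp only [Fin.forall_fin_succ', Fin.snoc_castSucc, Fin.snoc_last, Option.some.injEq,
        attach_adj_castSucc, attach_adj_last_left, attach_adj_last_right]
      refine ⟨fun a => ⟨fun b => h3 u' u'' a b, ?_⟩, ?_, ?_⟩
      · rintro ha rfl hadj
        have hb := h4 u' (hmem ha) hadj.symm
        exact h2 u' _ _ ha hb
      · rintro b rfl hb hadj
        exact h2 u'' _ _ hb (h4 u'' (hmem hb) hadj)
      · rintro rfl rfl hadj
        exact absurd rfl hadj.ne

lemma IsEmb.iso {H : SimpleGraph (Fin n)} (e : G ≃g H) {g : Fin n → Option α}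
    (h : IsEmb τ A G g) : IsEmb τ A H (g ∘ e.symm) := by
  refine ⟨fun u => (h.1 u).trans ⟨?_, ?_⟩, fun u v v' hv hv' => ?_,
    fun u u' v v' hv hv' hadj => ?_⟩
  · rintro ⟨v, hv⟩
    exact ⟨e v, by simpa using hv⟩
  · rintro ⟨v, hv⟩
    exact ⟨e.symm v, hv⟩
  · exact e.symm.injective (h.2.1 u _ _ hv hv')
  · exact e.symm.map_adj_iff.1 (h.2.2 u u' _ _ hv hv' hadj)

variable [Fintype α]

/-- The contribution to `embSum` of the new vertex being the image of `u`. -/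
lemma exists_newVertex_eq_embSum (u : α) {k : α → ℕ} (hk : ∀ u, 3 ≤ k u) (n : ℕ) :
    ∃ (c : ℝ) (k' : α → ℕ), (∀ u, 3 ≤ k' u) ∧ ∀ G : SimpleGraph (Fin n), TreeDeg G →
      (∑ g : Fin n → Option α, ∑ v,
        (if IsEmb τ (A.erase u) G g ∧ ∀ u' ∈ A.erase u, τ.Adj u u' → g v = some u'
          then (1 : ℝ) else 0) *
        ((deg G v + optLabel k (g v) : ℝ) * wt G fun a => optLabel k (g a))) =
      c * embSum τ (A.erase u) k' G := by
  by_cases h0 : ∃ u₁ ∈ A.erase u, τ.Adj u u₁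
  · obtain ⟨u₁, hu₁, hadj⟩ := h0
    by_cases h1 : ∃ u₂ ∈ A.erase u, τ.Adj u u₂ ∧ u₂ ≠ u₁
    · obtain ⟨u₂, hu₂, hadj₂, hne⟩ := h1
      refine ⟨0, k, hk, fun G _ => ?_⟩
      rw [zero_mul]
      refine sum_eq_zero fun g _ => sum_eq_zero fun v _ => ?_
      rw [if_neg, zero_mul]
      rintro ⟨-, h⟩
      exact hne (Option.some.inj ((h u₂ hu₂ hadj₂).symm.trans (h u₁ hu₁ hadj)))
    · push Not at h1
      refine ⟨1, fun a => k a + if a = u₁ then 1 else 0, fun a => (hk a).trans (Nat.le_add_right _ _),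
        fun G _ => ?_⟩
      rw [one_mul, embSum]
      refine sum_congr rfl fun g _ => ?_
      have hiff : ∀ v, (∀ u' ∈ A.erase u, τ.Adj u u' → g v = some u') ↔ g v = some u₁ := fun v =>
        ⟨fun h => h u₁ hu₁ hadj, fun h u' hu' ha => by rw [h1 u' hu' ha, h]⟩
      simp only [hiff]
      by_cases hg : IsEmb τ (A.erase u) G g
      · obtain ⟨v, hv⟩ := (hg.1 u₁).1 hu₁
        have huniq : ∀ v', g v' = some u₁ ↔ v' = v := fun v' =>
          ⟨fun h => hg.2.1 u₁ v' v h hv, fun h => h ▸ hv⟩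
        rw [sum_eq_single v (fun v' _ hne => by simp [huniq, hne]) (by simp), if_pos ⟨hg, hv⟩,
          if_pos hg, one_mul, deg_add_mul_wt v fun a => optLabel k (g a)]
        congr 1
        funext a
        simp only [← huniq]
        cases g a <;> simp [optLabel]
      · simp [hg]
  · push Not at h0
    refine ⟨2 * n - 2 + (∑ a ∈ A.erase u, k a : ℕ), k, hk, fun G hG => ?_⟩
    rw [embSum, mul_sum]
    refine sum_congr rfl fun g _ => ?_
    by_cases hg : IsEmb τ (A.erase u) G g
    · have hiff : ∀ v, ∀ u' ∈ A.erase u, τ.Adj u u' → g v = some u' :=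
        fun v u' hu' ha => absurd ha (h0 u' hu')
      rw [if_pos hg, ← hg.sum_optLabel k, ← hG.sum_deg_add_mul_wt]
      exact sum_congr rfl fun v _ => by rw [if_pos ⟨hg, hiff v⟩, one_mul]
    · simp [hg]

/-- The transition operator acts on weighted embedding counts triangularly. -/
lemma exists_step_embSum {k : α → ℕ} (hk : ∀ u, 3 ≤ k u) {n : ℕ} (hn : 2 ≤ n) :
    ∃ (c : α → ℝ) (k' : α → α → ℕ), (∀ u a, 3 ≤ k' u a) ∧ ∀ G : SimpleGraph (Fin n), TreeDeg G →
      step n (embSum τ A k) G = (1 + (∑ u ∈ A, k u : ℕ) / (2 * n - 2)) * embSum τ A k G +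
        ∑ u ∈ A, c u * embSum τ (A.erase u) (k' u) G := by
  choose c k' hk' hc using fun u => exists_newVertex_eq_embSum (τ := τ) (A := A) u hk n
  refine ⟨fun u => (k u).factorial * c u / (2 * n - 2), k', hk', fun G hG => ?_⟩
  have h2 : (2 : ℝ) ≤ n := by exact_mod_cast hn
  have hne : (2 * n - 2 : ℝ) ≠ 0 := by linarith
  have key := sum_deg_mul_sum_wt_attach (G := G) (optLabel k)
    (fun v g => if IsEmb τ A (attach G v) g then (1 : ℝ) else 0)
  have h1 : step n (embSum τ A k) G = (∑ v, (deg G v : ℝ) * ∑ g : Fin (n + 1) → Option α,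
      (if IsEmb τ A (attach G v) g then (1 : ℝ) else 0) *
        wt (attach G v) fun a => optLabel k (g a)) / (2 * n - 2) := by
    rw [step, sum_div]
    refine sum_congr rfl fun v _ => ?_
    simp only [embSum, ite_mul, one_mul, zero_mul]
    ring
  have hnone : ∑ g : Fin n → Option α, ∑ v, (if IsEmb τ A G g then (1 : ℝ) else 0) *
      ((deg G v + optLabel k (g v) : ℝ) * wt G fun a => optLabel k (g a)) =
      (2 * n - 2 + (∑ u ∈ A, k u : ℕ)) * embSum τ A k G := by
    rw [embSum, mul_sum]
    refine sum_congr rfl fun g _ => ?_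
    rw [← mul_sum, hG.sum_deg_add_mul_wt fun a => optLabel k (g a)]
    by_cases hg : IsEmb τ A G g
    · rw [if_pos hg, if_pos hg, hg.sum_optLabel, one_mul]
    · simp [hg]
  have hsome : ∀ u, (∑ g : Fin n → Option α, ∑ v, (if u ∈ A ∧ IsEmb τ (A.erase u) G g ∧
      ∀ u' ∈ A.erase u, τ.Adj u u' → g v = some u' then (1 : ℝ) else 0) *
      ((deg G v + optLabel k (g v) : ℝ) * wt G fun a => optLabel k (g a))) =
      if u ∈ A then c u * embSum τ (A.erase u) (k' u) G else 0 := by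
    intro u
    by_cases hu : u ∈ A
    · rw [if_pos hu, ← hc u G hG]
      simp only [hu, true_and]
    · simp [hu]
  rw [h1, key, Fintype.sum_option]
  simp only [isEmb_snoc_none, isEmb_snoc_some, hnone, hsome, optLabel_none, optLabel_some]
  rw [add_div, sum_div]
  congr 1
  · generalize (2 * n - 2 : ℝ) = D at hne
    simp
    field_simp
  · rw [← sum_subset (subset_univ A) fun u _ hu => by simp [hu]]
    refine sum_congr rfl fun u hu => ?_
    rw [if_pos hu]
    ring

lemma embSum_sq_le (k : α → ℕ) (G : SimpleGraph (Fin n)) :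
    embSum τ A k G ^ 2 ≤ momentSum (fun x : Option α × Option α => optLabel k x.1 + optLabel k x.2)
      (2 * ∑ u ∈ A, k u) G := by
  rw [sq, embSum, sum_mul_sum, ← Fintype.sum_prod_type', momentSum,
    ← (Equiv.arrowProdEquivProdArrow (Fin n) (fun _ => Option α) (fun _ => Option α)).sum_comp]
  refine sum_le_sum fun g _ => ?_
  simp only [Equiv.arrowProdEquivProdArrow_apply]
  by_cases h1 : IsEmb τ A G fun v => (g v).1
  · by_cases h2 : IsEmb τ A G fun v => (g v).2
    · rw [if_pos h1, if_pos h2, if_pos]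
      · exact wt_mul_le _ _
      · rw [sum_add_distrib, h1.sum_optLabel k, h2.sum_optLabel k, two_mul]
    · rw [if_neg h2, mul_zero]
      split_ifs
      exacts [wt_nonneg _, le_rfl]
  · rw [if_neg h1, zero_mul]
    split_ifs
    exacts [wt_nonneg _, le_rfl]

lemma invariant_embSum (τ : SimpleGraph α) (A : Finset α) (k : α → ℕ) (n : ℕ) :
    Invariant fun G : SimpleGraph (Fin n) => embSum τ A k G := by
  rintro G H ⟨e⟩
  symm
  dsimp only
  rw [embSum, embSum, ← (Equiv.arrowCongr e.toEquiv (Equiv.refl (Option α))).sum_comp]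
  refine sum_congr rfl fun g _ => ?_
  have hg : (Equiv.arrowCongr e.toEquiv (Equiv.refl (Option α))) g = g ∘ e.symm := rfl
  have hiff : IsEmb τ A H (g ∘ e.symm) ↔ IsEmb τ A G g :=
    ⟨fun h => by simpa [Function.comp_def] using h.iso e.symm, fun h => h.iso e⟩
  rw [hg]
  simp only [hiff]
  congr 1
  exact wt_iso e fun v => optLabel k (g v)

end Embedding

/-! ### Distinguishing two seeds -/

/-- Two vertices of distinct degrees exist in a graph with tree-like degrees. -/
lemma TreeDeg.exists_deg_ne {n : ℕ} {G : SimpleGraph (Fin n)} (h : TreeDeg G) (hn : 3 ≤ n) :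
    ∃ v v', deg G v ≠ deg G v' := by
  by_contra! hall
  let v₀ : Fin n := ⟨0, by lia⟩
  have hsum := h.2
  rw [sum_congr rfl fun v _ => hall v v₀, sum_const, card_univ, Fintype.card_fin,
    smul_eq_mul] at hsum
  rcases lt_or_ge (deg G v₀) 2 with hd | hd
  · interval_cases deg G v₀ <;> lia
  · have := Nat.mul_le_mul_left n hd
    lia

lemma lawAt_attach_pos {n₀ : ℕ} {S : SimpleGraph (Fin n₀)} (hS : TreeDeg S) (h₀ : 2 ≤ n₀) {n : ℕ}
    (hn : n₀ ≤ n) {G : SimpleGraph (Fin n)} (hG : lawAt S n G ≠ 0) (v : Fin n) :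
    0 < lawAt S (n + 1) (attach G v) := by
  have h2 : (2 : ℝ) ≤ n := by exact_mod_cast h₀.trans hn
  have hdeg : (0 : ℝ) < deg G v := by
    exact_mod_cast (treeDeg_of_lawAt_ne_zero hS hn G hG).1 v
  have hpos : 0 < lawAt S n G := (lawAt_nonneg (by lia) hn G).lt_of_ne' hG
  have hnn : ∀ H (w : Fin n), 0 ≤ lawAt S n H * ((deg H w : ℝ) / (2 * n - 2)) *
      (if attach H w = attach G v then 1 else 0) := fun H w =>
    mul_nonneg (mul_nonneg (lawAt_nonneg (by lia) hn H)
      (div_nonneg (Nat.cast_nonneg _) (by linarith))) (by split_ifs <;> norm_num)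
  rw [lawAt_succ hn]
  refine sum_pos' (fun H _ => sum_nonneg fun w _ => hnn H w) ⟨G, mem_univ _, ?_⟩
  refine sum_pos' (fun w _ => hnn G w) ⟨v, mem_univ _, ?_⟩
  rw [if_pos rfl, mul_one]
  exact mul_pos hpos (div_pos hdeg (by linarith))

lemma sum_sq_deg_iso {n : ℕ} {G H : SimpleGraph (Fin n)} (e : G ≃g H) :
    ∑ v, deg H v ^ 2 = ∑ v, deg G v ^ 2 := by
  rw [← e.toEquiv.sum_comp]
  exact sum_congr rfl fun v _ => congrArg (· ^ 2) (deg_iso e v)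

lemma exists_isoLaw_ne {n₁ n₂ : ℕ} {S₁ : SimpleGraph (Fin n₁)} {S₂ : SimpleGraph (Fin n₂)}
    (h₁ : TreeDeg S₁) (hn₁ : 3 ≤ n₁) (hle : n₁ ≤ n₂) (hiso : ¬ Nonempty (S₁ ≃g S₂)) :
    ∃ c, isoLaw S₁ n₂ c ≠ isoLaw S₂ n₂ c := by
  by_contra! hall
  simp only [isoLaw_self S₂] at hall
  rcases hle.eq_or_lt with rfl | hlt
  · have h := hall (Quotient.mk _ S₁)
    rw [isoLaw_self, if_pos rfl] at h
    split_ifs at h with hq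
    · exact hiso (Quotient.exact (s := isoSetoid n₁) hq.symm)
    · exact one_ne_zero h
  · obtain ⟨m, rfl⟩ := Nat.exists_eq_add_one_of_ne_zero (show n₂ ≠ 0 by lia)
    have hm : n₁ ≤ m := by lia
    have hone := expect_one h₁ (by lia) hm
    obtain ⟨G, -, hG⟩ := exists_ne_zero_of_sum_ne_zero
      (show (∑ G, lawAt S₁ m G * 1) ≠ 0 from hone.trans_ne one_ne_zero)
    rw [mul_one] at hG
    have hatt : ∀ v, Nonempty (S₂ ≃g attach G v) := by
      intro v
      have hpos := (lawAt_attach_pos h₁ (by lia) hm hG v).trans_le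
        (lawAt_le_isoLaw (by lia) (by lia) _)
      rw [hall] at hpos
      split_ifs at hpos with hq
      · exact Quotient.exact (s := isoSetoid (m + 1)) hq
      · exact absurd hpos (lt_irrefl 0)
    obtain ⟨v, v', hne⟩ := (treeDeg_of_lawAt_ne_zero h₁ hm G hG).exists_deg_ne (by lia)
    obtain ⟨e⟩ := hatt v
    obtain ⟨e'⟩ := hatt v'
    have h := (sum_sq_deg_iso e).trans (sum_sq_deg_iso e').symm
    rw [sum_sq_deg_attach, sum_sq_deg_attach] at h
    exact hne (by lia)

section EmbSumUniv

variable {n : ℕ} {τ G : SimpleGraph (Fin n)}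

lemma IsEmb.nonempty_iso (hτ : TreeDeg τ) (hG : TreeDeg G) {g : Fin n → Option (Fin n)}
    (h : IsEmb τ univ G g) : Nonempty (τ ≃g G) := by
  choose φ hφ using fun u => (h.1 u).1 (mem_univ u)
  have hinj : Function.Injective φ := fun a b hab =>
    Option.some.inj ((hφ a).symm.trans (hab ▸ hφ b))
  have hsum : ∑ v, deg τ v = ∑ v, deg G v := by
    have := hτ.2
    have := hG.2
    lia
  exact nonempty_iso_of_bijective_hom hsum (Equiv.ofBijective φ (Finite.injective_iff_bijective.1 hinj))
    fun a b hab => h.2.2 a b _ _ (hφ a) (hφ b) hab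

lemma embSum_univ_self_pos (hτ : TreeDeg τ) (k : Fin n → ℕ) : 0 < embSum τ univ k τ := by
  refine sum_pos' (fun g _ => ?_) ⟨some, mem_univ _, ?_⟩
  · split_ifs
    exacts [wt_nonneg _, le_rfl]
  · rw [if_pos]
    · exact wt_pos hτ _
    · refine ⟨fun u => by simp, fun u v v' hv hv' => ?_, fun u u' v v' hv hv' hadj => ?_⟩
      · exact Option.some.inj (hv.trans hv'.symm)
      · rwa [Option.some.inj hv, Option.some.inj hv']

lemma expect_embSum_univ {n₀ : ℕ} {S : SimpleGraph (Fin n₀)} (hS : TreeDeg S) (hn : n₀ ≤ n)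
    {c : Quotient (isoSetoid n)} (hc : TreeDeg c.out) (k : Fin n → ℕ) :
    expect S n (embSum c.out univ k) = isoLaw S n c * embSum c.out univ k c.out := by
  rw [expect_eq_sum_isoLaw (invariant_embSum _ _ _ _)]
  refine sum_eq_single c (fun b _ hb => ?_) (by simp)
  by_cases hb0 : isoLaw S n b = 0
  · rw [hb0, zero_mul]
  · rw [embSum, sum_eq_zero, mul_zero]
    refine fun g _ => if_neg fun hg => hb ?_
    have := hg.nonempty_iso hc (treeDeg_out_of_isoLaw_ne_zero hS hn hb0)
    rw [← b.out_eq, ← c.out_eq]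
    exact (Quotient.sound (s := isoSetoid n) this).symm

end EmbSumUniv

section Difference

variable {α : Type*} [Fintype α] {τ : SimpleGraph α} {n₁ n₂ : ℕ} {S₁ : SimpleGraph (Fin n₁)}
  {S₂ : SimpleGraph (Fin n₂)}

lemma expect_succ_embSum {A : Finset α} {k : α → ℕ} (hk : ∀ u, 3 ≤ k u) {n : ℕ} (hn : 2 ≤ n) :
    ∃ (c : α → ℝ) (k' : α → α → ℕ), (∀ u a, 3 ≤ k' u a) ∧
      ∀ {n₀ : ℕ} (S : SimpleGraph (Fin n₀)), TreeDeg S → n₀ ≤ n →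
        expect S (n + 1) (embSum τ A k) =
          (1 + (∑ u ∈ A, k u : ℕ) / (2 * n - 2)) * expect S n (embSum τ A k) +
            ∑ u ∈ A, c u * expect S n (embSum τ (A.erase u) (k' u)) := by
  obtain ⟨c, k', hk', h⟩ := exists_step_embSum (τ := τ) (A := A) hk hn
  refine ⟨c, k', hk', fun S hS hSn => ?_⟩
  rw [expect_succ hSn, expect_congr hS hSn h, expect_add, expect_const_mul, expect_sum]
  simp only [expect_const_mul]

/-- If all counts of embeddings of fewer than `r` vertices have equal expectations at time `N`,
then they do at all later times. -/
lemma expect_embSum_eq_of_card_lt (h₁ : TreeDeg S₁) (h₂ : TreeDeg S₂) {N r : ℕ} (hN : 2 ≤ N)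
    (hN₁ : n₁ ≤ N) (hN₂ : n₂ ≤ N)
    (h : ∀ (A : Finset α) (k : α → ℕ), #A < r → (∀ u, 3 ≤ k u) →
      expect S₁ N (embSum τ A k) = expect S₂ N (embSum τ A k)) {n : ℕ} (hn : N ≤ n) :
    ∀ (A : Finset α) (k : α → ℕ), #A < r → (∀ u, 3 ≤ k u) →
      expect S₁ n (embSum τ A k) = expect S₂ n (embSum τ A k) := by
  induction n, hn using Nat.le_induction with
  | base => exact h
  | succ n hn ih =>
    intro A k hA hk
    obtain ⟨c, k', hk', hrec⟩ := expect_succ_embSum (τ := τ) (A := A) hk (hN.trans hn)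
    rw [hrec S₁ h₁ (hN₁.trans hn), hrec S₂ h₂ (hN₂.trans hn), ih A k hA hk]
    congr 1
    exact sum_congr rfl fun u _ => by
      rw [ih _ _ ((card_le_card (erase_subset u A)).trans_lt hA) (hk' u)]

/-- At the first order at which the embedding counts differ, their difference grows
multiplicatively. -/
lemma expect_embSum_sub (h₁ : TreeDeg S₁) (h₂ : TreeDeg S₂) {N : ℕ} (hN : 2 ≤ N)
    (hN₁ : n₁ ≤ N) (hN₂ : n₂ ≤ N) {A : Finset α}
    (h : ∀ (B : Finset α) (k : α → ℕ), #B < #A → (∀ u, 3 ≤ k u) →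
      expect S₁ N (embSum τ B k) = expect S₂ N (embSum τ B k)) {k : α → ℕ} (hk : ∀ u, 3 ≤ k u)
    {n : ℕ} (hn : N ≤ n) :
    expect S₁ n (embSum τ A k) - expect S₂ n (embSum τ A k) =
      growth N (∑ u ∈ A, k u : ℕ) n *
        (expect S₁ N (embSum τ A k) - expect S₂ N (embSum τ A k)) := by
  induction n, hn using Nat.le_induction with
  | base => rw [growth_self, one_mul]
  | succ n hn ih =>
    obtain ⟨c, k', hk', hrec⟩ := expect_succ_embSum (τ := τ) (A := A) hk (hN.trans hn)
    have herase : ∑ u ∈ A, c u * expect S₁ n (embSum τ (A.erase u) (k' u)) =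
        ∑ u ∈ A, c u * expect S₂ n (embSum τ (A.erase u) (k' u)) :=
      sum_congr rfl fun u hu => by
        rw [expect_embSum_eq_of_card_lt h₁ h₂ hN hN₁ hN₂ h hn _ _ (card_erase_lt_of_mem hu)
          (hk' u)]
    rw [hrec S₁ h₁ (hN₁.trans hn), hrec S₂ h₂ (hN₂.trans hn), growth_succ hn, herase]
    linear_combination (1 + (∑ u ∈ A, k u : ℕ) / (2 * n - 2 : ℝ)) * ih

lemma exists_expect_embSum_sq_le {n₀ : ℕ} {S : SimpleGraph (Fin n₀)} (hS : TreeDeg S)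
    (h₀ : 1 ≤ n₀) {N : ℕ} (hN : 3 ≤ N) (A : Finset α) {k : α → ℕ} (hk : ∀ u, 3 ≤ k u) :
    ∃ C, 0 ≤ C ∧ ∀ᶠ n in Filter.atTop, expect S n (fun G => embSum τ A k G ^ 2) ≤
      C * growth N (∑ u ∈ A, k u : ℕ) n ^ 2 := by
  obtain ⟨C, hC⟩ := exists_expect_momentSum_le hS hN
    (w := fun x : Option α × Option α => optLabel k x.1 + optLabel k x.2) (x₀ := (none, none)) rfl
    (by
      rintro ⟨_ | u, _ | u'⟩ hx
      · exact absurd rfl hx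
      · exact (hk u').trans (Nat.le_add_left _ _)
      · exact (hk u).trans (Nat.le_add_right _ _)
      · exact (hk u).trans (Nat.le_add_right _ _)) (2 * ∑ u ∈ A, k u)
  refine ⟨|C|, abs_nonneg C, ?_⟩
  filter_upwards [hC, Filter.eventually_ge_atTop n₀] with n hn hn₀
  have hK : (0 : ℝ) ≤ (∑ u ∈ A, k u : ℕ) := Nat.cast_nonneg _
  refine (expect_mono h₀ hn₀ fun G => embSum_sq_le k G).trans (hn.trans ?_)
  rw [Nat.cast_mul, Nat.cast_two]
  exact (mul_le_mul_of_nonneg_right (le_abs_self C) (growth_pos hN (by linarith) n).le).trans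
    (mul_le_mul_of_nonneg_left (growth_two_mul_le hN hK n) (abs_nonneg C))

lemma exists_le_tvDist_of_expect_ne (h₁ : TreeDeg S₁) (h₂ : TreeDeg S₂) (hn₁ : 1 ≤ n₁)
    (hn₂ : 1 ≤ n₂) {N : ℕ} (hN : 3 ≤ N) (hN₁ : n₁ ≤ N) (hN₂ : n₂ ≤ N)
    (h : ∃ (A : Finset α) (k : α → ℕ), (∀ u, 3 ≤ k u) ∧
      expect S₁ N (embSum τ A k) ≠ expect S₂ N (embSum τ A k)) :
    ∃ ε : ℝ, 0 < ε ∧ ∀ᶠ n in Filter.atTop, ε ≤ tvDist S₁ S₂ n := by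
  have hex : ∃ (r : ℕ) (A : Finset α) (k : α → ℕ), #A = r ∧ (∀ u, 3 ≤ k u) ∧
      expect S₁ N (embSum τ A k) ≠ expect S₂ N (embSum τ A k) := by
    obtain ⟨A, k, hk, hne⟩ := h
    exact ⟨#A, A, k, rfl, hk, hne⟩
  obtain ⟨A, k, hA, hk, hne⟩ := Nat.find_spec hex
  have hmin : ∀ (B : Finset α) (k : α → ℕ), #B < #A → (∀ u, 3 ≤ k u) →
      expect S₁ N (embSum τ B k) = expect S₂ N (embSum τ B k) := by
    intro B k' hB hk'
    by_contra hBne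
    exact Nat.find_min hex (hA ▸ hB) ⟨B, k', rfl, hk', hBne⟩
  obtain ⟨C₁, hC₁0, hC₁⟩ := exists_expect_embSum_sq_le (τ := τ) h₁ hn₁ hN A hk
  obtain ⟨C₂, hC₂0, hC₂⟩ := exists_expect_embSum_sq_le (τ := τ) h₂ hn₂ hN A hk
  set δ := expect S₁ N (embSum τ A k) - expect S₂ N (embSum τ A k) with hδ
  have hδ0 : 0 < δ ^ 2 := by
    have := sub_ne_zero.2 hne
    positivity
  refine ⟨δ ^ 2 / (2 * (C₁ + C₂ + 1)), by positivity, ?_⟩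
  filter_upwards [hC₁, hC₂, Filter.eventually_ge_atTop N] with n hb₁ hb₂ hn
  have hcs := sq_expect_sub_le (S₁ := S₁) (S₂ := S₂) hn₁ hn₂ (hN₁.trans hn) (hN₂.trans hn)
    (invariant_embSum τ A k n)
  rw [expect_embSum_sub h₁ h₂ (by lia) hN₁ hN₂ hmin hk hn, ← hδ, mul_pow] at hcs
  have hK : (0 : ℝ) ≤ (∑ u ∈ A, k u : ℕ) := Nat.cast_nonneg _
  have hg := pow_pos (growth_pos hN (show (-3 : ℝ) ≤ (∑ u ∈ A, k u : ℕ) by linarith) n) 2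
  have htv := tvDist_nonneg S₁ S₂ n
  set γ := growth N (∑ u ∈ A, k u : ℕ) n ^ 2
  have hmain : γ * δ ^ 2 ≤ γ * (2 * tvDist S₁ S₂ n * (C₁ + C₂ + 1)) :=
    calc γ * δ ^ 2 ≤ 2 * tvDist S₁ S₂ n * (C₁ * γ + C₂ * γ) :=
          hcs.trans (mul_le_mul_of_nonneg_left (add_le_add hb₁ hb₂) (by positivity))
      _ ≤ γ * (2 * tvDist S₁ S₂ n * (C₁ + C₂ + 1)) := by nlinarith [mul_nonneg htv hg.le]
  rw [div_le_iff₀ (by positivity)]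
  linarith [le_of_mul_le_mul_left hmain hg]

end Difference

lemma exists_le_tvDist {n₁ n₂ : ℕ} {S₁ : SimpleGraph (Fin n₁)} {S₂ : SimpleGraph (Fin n₂)}
    (h₁ : TreeDeg S₁) (h₂ : TreeDeg S₂) (hn₁ : 3 ≤ n₁) (hle : n₁ ≤ n₂)
    (hiso : ¬ Nonempty (S₁ ≃g S₂)) :
    ∃ ε : ℝ, 0 < ε ∧ ∀ᶠ n in Filter.atTop, ε ≤ tvDist S₁ S₂ n := by
  obtain ⟨c, hc⟩ := exists_isoLaw_ne h₁ hn₁ hle hiso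
  have hT : TreeDeg c.out := by
    by_cases h0 : isoLaw S₁ n₂ c = 0
    · exact treeDeg_out_of_isoLaw_ne_zero h₂ le_rfl (h0 ▸ hc.symm)
    · exact treeDeg_out_of_isoLaw_ne_zero h₁ hle h0
  refine exists_le_tvDist_of_expect_ne (τ := c.out) h₁ h₂ (by lia) (by lia) (hn₁.trans hle) hle
    le_rfl ⟨univ, fun _ => 3, fun _ => le_rfl, ?_⟩
  rw [expect_embSum_univ h₁ hle hT, expect_embSum_univ h₂ le_rfl hT]
  exact fun h => hc (mul_right_cancel₀ (embSum_univ_self_pos hT _).ne' h)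

/-- **Influence of the seed graph** (Theorem 1 of Curien–Duquesne–Kortchemski–Manolescu).
For any two non-isomorphic finite trees `S₁` and `S₂`, each having at least `3` vertices, the
total variation distance between the laws of `T_n^{(S₁)}` and `T_n^{(S₂)}` stays bounded away
from `0`: `liminf_{n→∞} d_TV(T_n^{(S₁)}, T_n^{(S₂)}) > 0`; consequently the limit
`d(S₁,S₂) = lim_{n→∞} d_TV(T_n^{(S₁)}, T_n^{(S₂)})` exists and is strictly positive, so that
`d` is a metric on isomorphism classes of trees with at least three vertices. -/
theorem seed_influence
    {n₁ n₂ : ℕ} (S₁ : SimpleGraph (Fin n₁)) (S₂ : SimpleGraph (Fin n₂))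
    (h₁ : S₁.IsTree) (h₂ : S₂.IsTree) (hn₁ : 3 ≤ n₁) (hn₂ : 3 ≤ n₂)
    (hiso : ¬ Nonempty (S₁ ≃g S₂)) :
    0 < Filter.atTop.liminf (fun n => tvDist S₁ S₂ n) ∧
    ∃ L : ℝ, 0 < L ∧ Filter.Tendsto (fun n => tvDist S₁ S₂ n) Filter.atTop (nhds L) := by
  have t₁ := h₁.treeDeg (by lia)
  have t₂ := h₂.treeDeg (by lia)
  obtain ⟨ε, hε, hle⟩ : ∃ ε : ℝ, 0 < ε ∧ ∀ᶠ n in Filter.atTop, ε ≤ tvDist S₁ S₂ n := by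
    rcases le_total n₁ n₂ with h | h
    · exact exists_le_tvDist t₁ t₂ hn₁ h hiso
    · simp only [tvDist_comm S₁ S₂]
      exact exists_le_tvDist t₂ t₁ hn₂ h fun ⟨e⟩ => hiso ⟨e.symm⟩
  have hanti : Antitone fun n => tvDist S₁ S₂ (n + max n₁ n₂) := by
    refine antitone_nat_of_succ_le fun n => ?_
    rw [Nat.add_right_comm]
    exact tvDist_succ_le t₁ t₂ (by lia) (by lia) (by lia)
  have hbdd : BddBelow (Set.range fun n => tvDist S₁ S₂ (n + max n₁ n₂)) :=
    ⟨0, by rintro _ ⟨n, rfl⟩; exact tvDist_nonneg _ _ _⟩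
  have hlim := (Filter.tendsto_add_atTop_iff_nat (max n₁ n₂)).1 (tendsto_atTop_ciInf hanti hbdd)
  have hL := hε.trans_le (ge_of_tendsto hlim hle)
  exact ⟨hlim.liminf_eq.symm ▸ hL, _, hL, hlim⟩

end LPAM
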